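/- arXiv:0909.2524 — 2 statements merged into one kernel-verified Lean document; each statement's English description precedes it below -/
import Mathlib

section
/- Let X be the l_∞ sum of the closed unit disc D ⊆ ℝ² and the interval [0,1]: the set D × [0,1] with metric d((x,y),(x′,y′)) = max(d(x,x′), |y−y′|). In the lion and man game on X with the man starting at (0,0) (disc coordinate the origin, interval coordinate 0) and the lion starting at (0,1), both players have winning strategies: the lion has a strategy guaranteeing capture by time 1, and the man has a strategy guaranteeing he is never caught at any time t ∈ [0,∞). -/
/-!
On the l_∞ sum of the closed unit disc and [0,1], with the man starting at (0,0) and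
the lion at (0,1), both players have winning strategies.  (Note: in Mathlib the metric
on a product of metric spaces is the max metric, i.e. exactly the l_∞ sum.)
-/

open NNReal

noncomputable section

abbrev E2 := EuclideanSpace ℝ (Fin 2)

/-- The closed unit disc in the plane. -/
def Disc : Set E2 := Metric.closedBall 0 1

/-- The l_∞ sum of the closed unit disc and the interval [0,1]: the product set inside
`E2 × ℝ`, whose product metric is `dist ((x,y),(x',y')) = max (dist x x') |y - y'|`. -/
def DiscInterval : Set (E2 × ℝ) := Disc ×ˢ Set.Icc (0 : ℝ) 1

/-- A (speed at most 1) path in `S ⊆ E`, starting at `x`, defined on `[0,∞)`. -/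
def IsPathIn {E : Type*} [MetricSpace E] (S : Set E) (x : E) (f : ℝ≥0 → E) : Prop :=
  f 0 = x ∧ LipschitzWith 1 f ∧ ∀ t, f t ∈ S

/-- A lion strategy: a no-lookahead map from man paths to lion paths. -/
def IsLionStrategyIn {E : Type*} [MetricSpace E] (S : Set E) (xL xM : E)
    (Φ : (ℝ≥0 → E) → (ℝ≥0 → E)) : Prop :=
  (∀ m, IsPathIn S xM m → IsPathIn S xL (Φ m)) ∧
  ∀ m m', IsPathIn S xM m → IsPathIn S xM m' → ∀ t : ℝ≥0,
    (∀ s ≤ t, m s = m' s) → ∀ s ≤ t, Φ m s = Φ m' s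

/-- A man strategy: a no-lookahead map from lion paths to man paths. -/
def IsManStrategyIn {E : Type*} [MetricSpace E] (S : Set E) (xL xM : E)
    (Ψ : (ℝ≥0 → E) → (ℝ≥0 → E)) : Prop :=
  (∀ l, IsPathIn S xL l → IsPathIn S xM (Ψ l)) ∧
  ∀ l l', IsPathIn S xL l → IsPathIn S xL l' → ∀ t : ℝ≥0,
    (∀ s ≤ t, l s = l' s) → ∀ s ≤ t, Ψ l s = Ψ l' s

/-- There is a unit vector orthogonal to `p` making a nonobtuse angle with `p - a`. -/
theorem exists_unit_orthogonal_away (p a : E2) :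
    ∃ u : E2, ‖u‖ = 1 ∧ inner ℝ p u = 0 ∧ inner ℝ (a - p) u ≤ 0 := by
  obtain ⟨w, hw, hpw⟩ : ∃ w : E2, w ≠ 0 ∧ inner ℝ p w = 0 := by
    by_cases hp : p = 0
    · exact ⟨!₂[1, 0], fun h => by simpa using congrArg (fun v : E2 => v 0) h, by simp [hp]⟩
    · refine ⟨!₂[-p 1, p 0], fun h => hp ?_, ?_⟩
      · have h0 : -p 1 = 0 := by simpa using congrArg (fun v : E2 => v 0) h
        have h1 : p 0 = 0 := by simpa using congrArg (fun v : E2 => v 1) h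
        ext i
        fin_cases i
        · simpa using h1
        · simpa using h0
      · simp [PiLp.inner_apply, Fin.sum_univ_two]
        ring
  have hu : ‖‖w‖⁻¹ • w‖ = 1 := norm_smul_inv_norm (𝕜 := ℝ) hw
  have hpu : inner ℝ p (‖w‖⁻¹ • w) = 0 := by rw [inner_smul_right, hpw, mul_zero]
  rcases le_total (inner ℝ (a - p) (‖w‖⁻¹ • w)) 0 with h | h
  · exact ⟨_, hu, hpu, h⟩
  · exact ⟨-(‖w‖⁻¹ • w), by rw [norm_neg, hu], by rw [inner_neg_right, hpu, neg_zero],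
      by rw [inner_neg_right]; linarith⟩

/-- A direction in which a man at `p` can run away from a lion at `a`, orthogonally to `p`. -/
def awayDirection (p a : E2) : E2 := (exists_unit_orthogonal_away p a).choose

theorem norm_awayDirection (p a : E2) : ‖awayDirection p a‖ = 1 :=
  (exists_unit_orthogonal_away p a).choose_spec.1

theorem inner_awayDirection (p a : E2) : inner ℝ p (awayDirection p a) = 0 :=
  (exists_unit_orthogonal_away p a).choose_spec.2.1

theorem inner_sub_awayDirection_nonpos (p a : E2) :
    inner ℝ (a - p) (awayDirection p a) ≤ 0 :=
  (exists_unit_orthogonal_away p a).choose_spec.2.2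

/-- A pursuer at `a` who is not ahead of an evader at `p ≠ a` running in direction `u`
never reaches the evader. -/
theorem eq_of_eq_add_smul {F : Type*} [NormedAddCommGroup F] [InnerProductSpace ℝ F]
    {p a b u : F} {τ : ℝ} (hu : ‖u‖ = 1) (hap : inner ℝ (a - p) u ≤ 0) (hab : ‖b - a‖ ≤ τ)
    (hb : b = p + τ • u) : a = p := by
  have hτ : 0 ≤ τ := (norm_nonneg _).trans hab
  have hba : b - a = τ • u - (a - p) := by rw [hb]; abel
  have h1 : ‖b - a‖ ^ 2 = τ ^ 2 - 2 * (τ * inner ℝ (a - p) u) + ‖a - p‖ ^ 2 := by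
    rw [hba, norm_sub_sq_real, norm_smul, hu, real_inner_smul_left, real_inner_comm,
      Real.norm_eq_abs, mul_one, sq_abs]
  have h2 : ‖b - a‖ ^ 2 ≤ τ ^ 2 := pow_le_pow_left₀ (norm_nonneg _) hab 2
  have h3 : ‖a - p‖ ^ 2 ≤ 0 := by nlinarith [mul_nonneg hτ (neg_nonneg.2 hap)]
  exact sub_eq_zero.1 (norm_eq_zero.1 (pow_eq_zero_iff two_ne_zero |>.1
    (le_antisymm h3 (sq_nonneg _))))

/-- The time at which the man changes direction for the `n`-th time. -/
def turnTime (n : ℕ) : ℝ := ∑ k ∈ Finset.range n, 1 / ((k : ℝ) + 2)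

theorem turnTime_zero : turnTime 0 = 0 := by simp [turnTime]

theorem turnTime_succ (n : ℕ) : turnTime (n + 1) = turnTime n + 1 / ((n : ℝ) + 2) :=
  Finset.sum_range_succ _ _

theorem turnTime_mono : Monotone turnTime :=
  monotone_nat_of_le_succ fun n => by
    rw [turnTime_succ]
    have : (0 : ℝ) ≤ 1 / ((n : ℝ) + 2) := by positivity
    linarith

theorem turnTime_nonneg (n : ℕ) : 0 ≤ turnTime n :=
  turnTime_zero ▸ turnTime_mono (Nat.zero_le n)

theorem exists_le_turnTime (t : ℝ) : ∃ n, t ≤ turnTime n := by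
  have h := Real.tendsto_sum_range_one_div_nat_succ_atTop
  obtain ⟨n, hn⟩ :=
    ((h.comp (Filter.tendsto_add_atTop_nat 1)).eventually_ge_atTop (t + 1)).exists
  refine ⟨n, ?_⟩
  rw [Function.comp_apply, Finset.sum_range_succ'] at hn
  have : ∀ k : ℕ, 1 / (((k + 1 : ℕ) : ℝ) + 1) = 1 / ((k : ℝ) + 2) := fun k => by
    push_cast; ring
  simp only [this] at hn
  norm_num at hn
  simpa [turnTime] using hn

/-- A fixed unit vector of the plane. -/
def firstAxis : E2 := awayDirection 0 0

open Classical in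
/-- The first direction of the man: it differs from the direction that the lion takes
immediately after time `0`. -/
def initialDirection (q : ℝ → E2) : E2 :=
  if ∃ ε > 0, ∀ s, 0 ≤ s → s ≤ ε → q s = s • firstAxis then -firstAxis else firstAxis

theorem norm_initialDirection (q : ℝ → E2) : ‖initialDirection q‖ = 1 := by
  unfold initialDirection
  split_ifs
  · rw [norm_neg]; exact norm_awayDirection 0 0
  · exact norm_awayDirection 0 0

open Classical in
theorem initialDirection_congr {q q' : ℝ → E2} {t : ℝ} (ht : 0 < t)
    (h : ∀ s, 0 ≤ s → s ≤ t → q s = q' s) : initialDirection q = initialDirection q' := by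
  have aux : ∀ {q q' : ℝ → E2}, (∀ s, 0 ≤ s → s ≤ t → q s = q' s) →
      (∃ ε > 0, ∀ s, 0 ≤ s → s ≤ ε → q s = s • firstAxis) →
      ∃ ε > 0, ∀ s, 0 ≤ s → s ≤ ε → q' s = s • firstAxis := by
    rintro q q' h ⟨ε, hε, H⟩
    refine ⟨min ε t, lt_min hε ht, fun s hs hs' => ?_⟩
    rw [← h s hs (hs'.trans (min_le_right _ _)), H s hs (hs'.trans (min_le_left _ _))]
  have : (∃ ε > 0, ∀ s, 0 ≤ s → s ≤ ε → q s = s • firstAxis) ↔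
      ∃ ε > 0, ∀ s, 0 ≤ s → s ≤ ε → q' s = s • firstAxis :=
    ⟨aux h, aux fun s hs hs' => (h s hs hs').symm⟩
  unfold initialDirection
  exact if_congr this rfl rfl

/-- A lion starting at the origin cannot run along with the man in his initial direction. -/
theorem ne_smul_initialDirection {q : ℝ → E2} (h0 : q 0 = 0)
    (hq : ∀ s t, 0 ≤ s → s ≤ t → ‖q t - q s‖ ≤ t - s) {t : ℝ} (ht : 0 < t) :
    q t ≠ t • initialDirection q := by
  intro h
  have key : ∀ s, 0 ≤ s → s ≤ t → q s = s • initialDirection q := fun s hs hst => by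
    have hu := norm_initialDirection q
    refine eq_of_eq_add_smul (τ := t - s) hu ?_ (hq s t hs hst) ?_
    · have h1 : inner ℝ (q s) (initialDirection q) ≤ ‖q s‖ * ‖initialDirection q‖ :=
        real_inner_le_norm _ _
      have h2 := hq 0 s le_rfl hs
      rw [h0, sub_zero, sub_zero] at h2
      rw [inner_sub_left, real_inner_smul_left, real_inner_self_eq_norm_sq, hu]
      rw [hu] at h1
      linarith
    · rw [h, ← add_smul]; congr 1; ring
  by_cases hG : ∃ ε > 0, ∀ s, 0 ≤ s → s ≤ ε → q s = s • firstAxis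
  · have hd : initialDirection q = -firstAxis := if_pos hG
    obtain ⟨ε, hε, H⟩ := hG
    have hs : 0 < min ε t := lt_min hε ht
    have h1 := H _ hs.le (min_le_left _ _)
    rw [key _ hs.le (min_le_right _ _), hd, smul_neg] at h1
    have h2 : min ε t • firstAxis = 0 := by
      have h4 : (2 : ℝ) • min ε t • firstAxis = 0 := by
        rw [two_smul]
        nth_rewrite 1 [← h1]
        exact neg_add_cancel _
      exact (smul_eq_zero.1 h4).resolve_left two_ne_zero
    have h3 : ‖firstAxis‖ = 1 := norm_awayDirection 0 0
    rcases smul_eq_zero.1 h2 with h2 | h2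
    · exact hs.ne' h2
    · rw [h2, norm_zero] at h3
      exact zero_ne_one h3
  · have hd : initialDirection q = firstAxis := if_neg hG
    rw [hd] at key
    exact hG ⟨t, ht, key⟩

/-- The direction of the man between the `n`-th and `(n + 1)`-st turning times, if he is at
`p` at the former. -/
def direction (q : ℝ → E2) (n : ℕ) (p : E2) : E2 :=
  if n = 0 then initialDirection q else awayDirection p (q (turnTime n))

theorem norm_direction (q : ℝ → E2) (n : ℕ) (p : E2) : ‖direction q n p‖ = 1 := by
  unfold direction
  split_ifs
  · exact norm_initialDirection q
  · exact norm_awayDirection _ _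

/-- The path in the disc of the evading man against the lion `q`, stopped at the `n`-th
turning time. -/
def evasion (q : ℝ → E2) : ℕ → ℝ → E2
  | 0, _ => 0
  | n + 1, t => evasion q n t + (min t (turnTime (n + 1)) - min t (turnTime n)) •
      direction q n (evasion q n (turnTime n))

theorem evasion_succ_of_le (q : ℝ → E2) {n : ℕ} {t : ℝ} (ht : t ≤ turnTime n) :
    evasion q (n + 1) t = evasion q n t := by
  rw [evasion, min_eq_left ht, min_eq_left (ht.trans (turnTime_mono n.le_succ)), sub_self,
    zero_smul, add_zero]

theorem evasion_eq_of_le (q : ℝ → E2) {n k : ℕ} (hnk : n ≤ k) {t : ℝ} (ht : t ≤ turnTime n) :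
    evasion q k t = evasion q n t := by
  induction k, hnk using Nat.le_induction with
  | base => rfl
  | succ k hk ih => rw [evasion_succ_of_le q (ht.trans (turnTime_mono hk)), ih]

theorem norm_evasion_sub_le (q : ℝ → E2) (n : ℕ) {s t : ℝ} (hs : 0 ≤ s) (hst : s ≤ t) :
    ‖evasion q n t - evasion q n s‖ ≤ min t (turnTime n) - min s (turnTime n) := by
  induction n with
  | zero => simp [evasion, turnTime_zero, hs, hs.trans hst]
  | succ n ih =>
    have hm : turnTime n ≤ turnTime (n + 1) := turnTime_mono n.le_succ
    have hinc : 0 ≤ (min t (turnTime (n + 1)) - min t (turnTime n)) -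
        (min s (turnTime (n + 1)) - min s (turnTime n)) := by grind
    rw [evasion, evasion, add_sub_add_comm, ← sub_smul]
    refine (norm_add_le _ _).trans ?_
    rw [norm_smul, norm_direction, mul_one, Real.norm_of_nonneg hinc]
    linarith

theorem evasion_of_ge (q : ℝ → E2) {n : ℕ} {t : ℝ} (ht : turnTime n ≤ t) :
    evasion q n t = evasion q n (turnTime n) := by
  have := norm_evasion_sub_le q n (turnTime_nonneg n) ht
  rw [min_eq_right ht, min_self, sub_self, norm_le_zero_iff, sub_eq_zero] at this
  exact this

theorem evasion_succ_of_ge (q : ℝ → E2) {n : ℕ} {t : ℝ} (h : turnTime n ≤ t) :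
    evasion q (n + 1) t = evasion q n (turnTime n) + (min t (turnTime (n + 1)) - turnTime n) •
      direction q n (evasion q n (turnTime n)) := by
  rw [evasion, evasion_of_ge q h, min_eq_right h]

theorem inner_direction (q : ℝ → E2) (n : ℕ) :
    inner ℝ (evasion q n (turnTime n)) (direction q n (evasion q n (turnTime n))) = 0 := by
  cases n with
  | zero => simp [evasion]
  | succ n => rw [direction, if_neg n.succ_ne_zero, inner_awayDirection]

theorem norm_evasion_sq_le (q : ℝ → E2) (n : ℕ) (t : ℝ) :
    ‖evasion q n t‖ ^ 2 ≤ 1 - 1 / ((n : ℝ) + 1) := by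
  induction n generalizing t with
  | zero => simp [evasion]
  | succ n ih =>
    have hn : (0 : ℝ) ≤ n := n.cast_nonneg
    have hsum : 1 / ((n : ℝ) + 2) ^ 2 ≤ 1 / ((n : ℝ) + 1) - 1 / ((n : ℝ) + 2) := by
      rw [div_sub_div _ _ (by positivity) (by positivity),
        div_le_div_iff₀ (by positivity) (by positivity)]
      nlinarith
    have hpos : 0 ≤ 1 / ((n : ℝ) + 2) ^ 2 := by positivity
    have hcast : (((n + 1 : ℕ) : ℝ) + 1) = (n : ℝ) + 2 := by push_cast; ring
    rw [hcast]
    rcases le_total t (turnTime n) with h | h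
    · rw [evasion_succ_of_le q h]
      linarith [ih t]
    · rw [evasion_succ_of_ge q h, norm_add_sq_real, real_inner_smul_right, inner_direction,
        norm_smul, norm_direction, mul_one, Real.norm_eq_abs, sq_abs]
      have h1 : min t (turnTime (n + 1)) - turnTime n ≤ 1 / ((n : ℝ) + 2) := by
        have := min_le_right t (turnTime (n + 1))
        rw [turnTime_succ] at this ⊢
        linarith
      have h2 : 0 ≤ min t (turnTime (n + 1)) - turnTime n :=
        sub_nonneg.2 (le_min h (turnTime_mono n.le_succ))
      have h3 := pow_le_pow_left₀ h2 h1 2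
      rw [div_pow, one_pow] at h3
      linarith [ih (turnTime n)]

theorem evasion_congr {q q' : ℝ → E2} {t : ℝ} (h : ∀ s, 0 ≤ s → s ≤ t → q s = q' s) (n : ℕ)
    {s : ℝ} (hs : s ≤ t) : evasion q n s = evasion q' n s := by
  induction n generalizing s with
  | zero => rfl
  | succ n ih =>
    rcases le_or_gt s (turnTime n) with hsn | hsn
    · rw [evasion_succ_of_le q hsn, evasion_succ_of_le q' hsn, ih hs]
    · have hnt : turnTime n < t := hsn.trans_le hs
      have hd : direction q n = direction q' n := by
        funext p
        unfold direction
        rw [initialDirection_congr ((turnTime_nonneg n).trans_lt hnt) h,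
          h _ (turnTime_nonneg n) hnt.le]
      rw [evasion, evasion, ih hs, ih hnt.le, hd]

theorem evasion_ne {q : ℝ → E2} (h0 : q 0 = 0)
    (hq : ∀ s t, 0 ≤ s → s ≤ t → ‖q t - q s‖ ≤ t - s) (n : ℕ) {t : ℝ} (ht : 0 < t)
    (htn : t ≤ turnTime n) : q t ≠ evasion q n t := by
  induction n generalizing t with
  | zero => exact absurd htn (by rw [turnTime_zero]; exact ht.not_ge)
  | succ n ih =>
    rcases le_total t (turnTime n) with h | h
    · rw [evasion_succ_of_le q h]
      exact ih ht h
    · rw [evasion_succ_of_ge q h, min_eq_left htn]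
      cases n with
      | zero =>
        simpa [turnTime_zero, evasion, direction] using ne_smul_initialDirection h0 hq ht
      | succ k =>
        have hT : 0 < turnTime (k + 1) := by
          rw [turnTime_succ]
          have := turnTime_nonneg k
          positivity
        rw [direction, if_neg k.succ_ne_zero]
        exact fun H => ih hT le_rfl (eq_of_eq_add_smul (norm_awayDirection _ _)
          (inner_sub_awayDirection_nonpos _ _) (hq _ _ hT.le h) H)

/-- The path in the disc of the evading man against the lion `q`. -/
def evasionPath (q : ℝ → E2) (t : ℝ) : E2 := evasion q (exists_le_turnTime t).choose t

theorem evasionPath_eq (q : ℝ → E2) {n : ℕ} {t : ℝ} (ht : t ≤ turnTime n) :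
    evasionPath q t = evasion q n t := by
  have hc := (exists_le_turnTime t).choose_spec
  rcases le_total (exists_le_turnTime t).choose n with h | h
  · exact (evasion_eq_of_le q h hc).symm
  · exact evasion_eq_of_le q h ht

theorem norm_evasionPath_sub_le (q : ℝ → E2) {s t : ℝ} (hs : 0 ≤ s) (hst : s ≤ t) :
    ‖evasionPath q t - evasionPath q s‖ ≤ t - s := by
  obtain ⟨n, hn⟩ := exists_le_turnTime t
  rw [evasionPath_eq q hn, evasionPath_eq q (hst.trans hn)]
  simpa [hn, hst.trans hn] using norm_evasion_sub_le q n hs hst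

theorem norm_evasionPath_le (q : ℝ → E2) (t : ℝ) : ‖evasionPath q t‖ ≤ 1 := by
  have h := norm_evasion_sq_le q (exists_le_turnTime t).choose t
  have hpos : (0 : ℝ) ≤ 1 / (((exists_le_turnTime t).choose : ℝ) + 1) := by positivity
  exact (sq_le_one_iff₀ (norm_nonneg _)).1 (h.trans (by linarith))

theorem lipschitzWith_one_of_dist_le {F : Type*} [PseudoMetricSpace F] {f : ℝ≥0 → F}
    (h : ∀ s t : ℝ≥0, s ≤ t → dist (f t) (f s) ≤ t - s) : LipschitzWith 1 f := by
  refine LipschitzWith.of_dist_le_mul fun x y => ?_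
  rw [NNReal.coe_one, one_mul, NNReal.dist_eq]
  rcases le_total x y with hxy | hxy
  · rw [dist_comm, abs_sub_comm]
    exact (h x y hxy).trans (le_abs_self _)
  · exact (h y x hxy).trans (le_abs_self _)

theorem exists_lion_strategy :
    ∃ Φ, IsLionStrategyIn DiscInterval ((0 : E2), (1 : ℝ)) ((0 : E2), (0 : ℝ)) Φ ∧
      ∀ m, IsPathIn DiscInterval ((0 : E2), (0 : ℝ)) m → ∃ t : ℝ≥0, t ≤ 1 ∧ Φ m t = m t := by
  refine ⟨fun m t => ((m t).1, max 0 (1 - (t : ℝ))), ⟨fun m hm => ⟨?_, ?_, fun t => ?_⟩, ?_⟩,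
    fun m hm => ?_⟩
  · simp [hm.1]
  · refine lipschitzWith_one_of_dist_le fun s t hst => ?_
    have hst' : (s : ℝ) ≤ t := hst
    rw [Prod.dist_eq]
    refine max_le ?_ ?_
    · have h := hm.2.1.dist_le_mul t s
      rw [NNReal.coe_one, one_mul, NNReal.dist_eq, abs_of_nonneg (sub_nonneg.2 hst'),
        Prod.dist_eq] at h
      exact (le_max_left _ _).trans h
    · rw [Real.dist_eq, abs_le]
      constructor <;> grind
  · refine ⟨(hm.2.2 t).1, le_max_left _ _, max_le zero_le_one ?_⟩
    linarith [t.coe_nonneg]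
  · intro m m' _ _ t h s hs
    simp only [h s hs]
  · have hc : Continuous fun t : ℝ≥0 => (m t).2 - (1 - (t : ℝ)) := by
      have := hm.2.1.continuous
      fun_prop
    have h0 : (m 0).2 - (1 - ((0 : ℝ≥0) : ℝ)) ≤ 0 := by simp [hm.1]
    have h1 : 0 ≤ (m 1).2 - (1 - ((1 : ℝ≥0) : ℝ)) := by simpa using (hm.2.2 1).2.1
    obtain ⟨t, ht, h⟩ := intermediate_value_Icc (zero_le_one (α := ℝ≥0)) hc.continuousOn ⟨h0, h1⟩
    refine ⟨t, ht.2, Prod.ext rfl ?_⟩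
    have ht1 : (t : ℝ) ≤ 1 := by exact_mod_cast ht.2
    change max 0 (1 - (t : ℝ)) = (m t).2
    rw [max_eq_right (by linarith)]
    simp only at h
    linarith

theorem exists_man_strategy :
    ∃ Ψ, IsManStrategyIn DiscInterval ((0 : E2), (1 : ℝ)) ((0 : E2), (0 : ℝ)) Ψ ∧
      ∀ l, IsPathIn DiscInterval ((0 : E2), (1 : ℝ)) l → ∀ t : ℝ≥0, Ψ l t ≠ l t := by
  refine ⟨fun l t => (evasionPath (fun s => (l s.toNNReal).1) t, 0),
    ⟨fun l hl => ⟨?_, ?_, fun t => ?_⟩, ?_⟩, fun l hl t => ?_⟩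
  · simp only
    rw [NNReal.coe_zero, evasionPath_eq _ turnTime_zero.ge, evasion]
  · refine lipschitzWith_one_of_dist_le fun s t hst => ?_
    have hst' : (s : ℝ) ≤ t := hst
    rw [Prod.dist_eq, dist_self, dist_eq_norm]
    exact max_le (norm_evasionPath_sub_le _ s.coe_nonneg hst') (sub_nonneg.2 hst')
  · exact ⟨mem_closedBall_zero_iff.2 (norm_evasionPath_le _ _), le_rfl, zero_le_one⟩
  · intro l l' _ _ t h s hs
    refine Prod.ext (evasion_congr (t := t) (fun r _ hr => ?_) _ (NNReal.coe_le_coe.2 hs)) rfl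
    rw [h _ (Real.toNNReal_le_iff_le_coe.2 hr)]
  · intro H
    rcases eq_zero_or_pos t with rfl | ht
    · have := congrArg Prod.snd H
      rw [hl.1] at this
      exact zero_ne_one this
    · obtain ⟨n, hn⟩ := exists_le_turnTime (t : ℝ)
      refine evasion_ne (q := fun s => (l s.toNNReal).1) (by simp [hl.1]) (fun s r hs hsr => ?_) n
        (NNReal.coe_pos.2 ht) hn ?_
      · have h := hl.2.1.dist_le_mul r.toNNReal s.toNNReal
        rw [NNReal.coe_one, one_mul, NNReal.dist_eq, Real.coe_toNNReal _ hs,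
          Real.coe_toNNReal _ (hs.trans hsr), abs_of_nonneg (sub_nonneg.2 hsr), Prod.dist_eq] at h
        rw [← dist_eq_norm]
        exact (le_max_left _ _).trans h
      · rw [← evasionPath_eq _ hn, Real.toNNReal_coe]
        exact (congrArg Prod.fst H).symm

/-- On the l_∞ sum of the closed unit disc and `[0,1]`, with the man starting at
`(0,0)` and the lion at `(0,1)`, both players have winning strategies: the lion can
guarantee capture by time 1, and the man can guarantee never to be caught. -/
theorem both_win_on_disc_times_interval :
    (∃ Φ, IsLionStrategyIn DiscInterval ((0 : E2), (1 : ℝ)) ((0 : E2), (0 : ℝ)) Φ ∧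
      ∀ m, IsPathIn DiscInterval ((0 : E2), (0 : ℝ)) m →
        ∃ t : ℝ≥0, t ≤ 1 ∧ Φ m t = m t) ∧
    (∃ Ψ, IsManStrategyIn DiscInterval ((0 : E2), (1 : ℝ)) ((0 : E2), (0 : ℝ)) Ψ ∧
      ∀ l, IsPathIn DiscInterval ((0 : E2), (1 : ℝ)) l →
        ∀ t : ℝ≥0, Ψ l t ≠ l t) :=
  ⟨exists_lion_strategy, exists_man_strategy⟩

end
end

section
/- Let X be a metric space and x, z ∈ X points such that: (i) every speed-at-most-1 path starting at x that reaches z attains, at some time before reaching z, a point at distance strictly greater than 1 from z; and (ii) for every ε > 0 there is a speed-at-most-1 path starting at x that reaches z within time 1 + ε. Then in the race-to-a-point game on X with both players starting at x and target z, neither player has a winning strategy. (The paper's instance: X consists of two points x, z joined by disjoint arcs of length 1 + 1/n for every n ≥ 1, so that d(x,z) = 1 but no path from x to z has length 1.) -/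
/-!
Race to a point: if every path from x to z must first go to distance more than 1 from z,
but there are paths from x reaching z in time 1 + ε for every ε > 0, then in the race
to a point game with both players starting at x and target z, neither player has a
winning strategy.
-/

open NNReal ENNReal

noncomputable section

/-- A (speed at most 1) path in `X` starting at `x`, defined on `[0,∞)`. -/
def IsPath {X : Type*} [MetricSpace X] (x : X) (f : ℝ≥0 → X) : Prop :=
  f 0 = x ∧ LipschitzWith 1 f

/-- The first time a path `p` reaches the point `z` (`∞` if it never does). -/
def reachTime {X : Type*} [MetricSpace X] (z : X) (p : ℝ≥0 → X) : ℝ≥0∞ :=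
  ⨅ t ∈ {t : ℝ≥0 | p t = z}, (t : ℝ≥0∞)

/-- A strategy for the player starting at `xSelf`, responding to paths of the opponent
who starts at `xOpp`: a no-lookahead map from opponent paths to own paths. -/
def IsRaceStrategy {X : Type*} [MetricSpace X] (xOpp xSelf : X)
    (Φ : (ℝ≥0 → X) → (ℝ≥0 → X)) : Prop :=
  (∀ b, IsPath xOpp b → IsPath xSelf (Φ b)) ∧
  ∀ b b', IsPath xOpp b → IsPath xOpp b' → ∀ t : ℝ≥0,
    (∀ s ≤ t, b s = b' s) → ∀ s ≤ t, Φ b s = Φ b' s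

theorem reachTime_le {X : Type*} [MetricSpace X] {z : X} {p : ℝ≥0 → X} {t : ℝ≥0}
    (h : p t = z) : reachTime z p ≤ t :=
  iInf₂_le t h

theorem exists_of_reachTime_lt {X : Type*} [MetricSpace X] {z : X} {p : ℝ≥0 → X} {c : ℝ≥0∞}
    (h : reachTime z p < c) : ∃ t : ℝ≥0, p t = z ∧ (t : ℝ≥0∞) < c := by
  simpa [reachTime, iInf_lt_iff] using h

theorem IsPath.const {X : Type*} [MetricSpace X] (x : X) : IsPath x (fun _ => x) :=
  ⟨rfl, LipschitzWith.const' x⟩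

/-- Waiting at the starting point until time `s` and then following a path is again a path. -/
theorem IsPath.delay {X : Type*} [MetricSpace X] {x : X} {p : ℝ≥0 → X} (hp : IsPath x p)
    (s : ℝ≥0) : IsPath x (fun t => p (t - s)) := by
  refine ⟨by simpa using hp.1, LipschitzWith.of_dist_le_mul fun u v => ?_⟩
  refine (hp.2.dist_le_mul _ _).trans ?_
  gcongr
  rw [NNReal.dist_eq, NNReal.dist_eq, NNReal.coe_sub_def, NNReal.coe_sub_def]
  exact abs_max_sub_max_le_abs _ _ _ |>.trans (by simp)

/-- A path reaching `z` has a first time of reaching it. -/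
theorem IsPath.exists_first {X : Type*} [MetricSpace X] {x z : X} {p : ℝ≥0 → X}
    (hp : IsPath x p) {t : ℝ≥0} (ht : p t = z) :
    ∃ T : ℝ≥0, p T = z ∧ ∀ u, p u = z → T ≤ u := by
  have hc : IsClosed {u | p u = z} := isClosed_eq hp.2.continuous continuous_const
  exact ⟨sInf {u | p u = z}, hc.csInf_mem ⟨t, ht⟩ (OrderBot.bddBelow _),
    fun u hu => csInf_le (OrderBot.bddBelow _) hu⟩

/-- Against any strategy, the opponent can wait at `x` until the strategy has moved to distance
more than `1` from `z`, and then run. -/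
theorem not_exists_winning_raceStrategy {X : Type*} [MetricSpace X] (x z : X)
    (h1 : ∀ p : ℝ≥0 → X, IsPath x p → ∀ t : ℝ≥0, p t = z →
      ∃ s : ℝ≥0, s < t ∧ 1 < dist (p s) z)
    (h2 : ∀ ε : ℝ, 0 < ε → ∃ p : ℝ≥0 → X, IsPath x p ∧
      ∃ t : ℝ≥0, (t : ℝ) ≤ 1 + ε ∧ p t = z) :
    ¬ ∃ Φ, IsRaceStrategy x x Φ ∧
      ∀ b, IsPath x b → reachTime z (Φ b) < reachTime z b := by
  rintro ⟨Φ, ⟨hpath, hlook⟩, hwin⟩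
  have hconst := IsPath.const x
  obtain ⟨t₀, ht₀, -⟩ := exists_of_reachTime_lt (hwin _ hconst)
  obtain ⟨T, hT, hmin⟩ := (hpath _ hconst).exists_first ht₀
  obtain ⟨s, hsT, hs⟩ := h1 _ (hpath _ hconst) T hT
  obtain ⟨p, hp, r, hr, hpr⟩ := h2 (dist (Φ (fun _ => x) s) z - 1) (by linarith)
  have hb := hp.delay s
  have hagree := hlook _ _ hb hconst s fun u hu => by simp [tsub_eq_zero_of_le hu, hp.1]
  have hreach : reachTime z (fun t => p (t - s)) ≤ ((s + r : ℝ≥0) : ℝ≥0∞) :=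
    reachTime_le (by simpa using hpr)
  obtain ⟨t, ht, htlt⟩ := exists_of_reachTime_lt ((hwin _ hb).trans_le hreach)
  have htlt : (t : ℝ) < s + r := by exact_mod_cast htlt
  rcases le_or_gt t s with hts | hst
  · exact (hmin t (by rw [← hagree t hts, ht])).not_gt (hts.trans_lt hsT)
  · have hd := (hpath _ hb).2.dist_le_mul s t
    have hst : (s : ℝ) < t := by exact_mod_cast hst
    rw [hagree s le_rfl, ht, NNReal.dist_eq, abs_sub_comm, abs_of_pos (sub_pos.2 hst),
      NNReal.coe_one, one_mul] at hd
    linarith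

/-- Suppose that in `X`: (i) every speed-at-most-1 path starting at `x` that reaches `z`
is, at some earlier time, at distance strictly greater than 1 from `z`; and (ii) for
every `ε > 0` some speed-at-most-1 path from `x` reaches `z` within time `1 + ε`.
Then in the race-to-a-point game on `X` with both players starting at `x` and target
`z`, neither player has a winning strategy. -/
theorem race_to_point_no_winner
    {X : Type*} [MetricSpace X] (x z : X)
    (h1 : ∀ p : ℝ≥0 → X, IsPath x p → ∀ t : ℝ≥0, p t = z →
      ∃ s : ℝ≥0, s < t ∧ 1 < dist (p s) z)
    (h2 : ∀ ε : ℝ, 0 < ε → ∃ p : ℝ≥0 → X, IsPath x p ∧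
      ∃ t : ℝ≥0, (t : ℝ) ≤ 1 + ε ∧ p t = z) :
    (¬ ∃ Φ, IsRaceStrategy x x Φ ∧
      ∀ b, IsPath x b → reachTime z (Φ b) < reachTime z b) ∧
    (¬ ∃ Ψ, IsRaceStrategy x x Ψ ∧
      ∀ a, IsPath x a → reachTime z (Ψ a) < reachTime z a) :=
  ⟨not_exists_winning_raceStrategy x z h1 h2, not_exists_winning_raceStrategy x z h1 h2⟩

end
end
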